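/- Let p ≥ 3 be an odd integer and let T̂ = T + E ∈ ⊗^p ℝ^n, where T = Σ_{i=1}^n λ_i v_i^⊗p is SOD with λ_i > 0 for all i, {v₁,…,v_n} an orthonormal basis of ℝ^n, and E is a symmetric tensor with operator norm ε := ‖E‖. Let x̂ be a maximizer of T̂ x^⊗p over unit vectors x and let λ̂ := T̂ x̂^⊗p. Then there exists j ∈ {1,…,n} such that |λ̂ − λ_j| ≤ ε and ‖x̂ − v_j‖₂ ≤ 10(ε/λ_j + (ε/λ_j)²). -/

import Mathlib

open scoped RealInnerProductSpace BigOperators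

/-- The symmetric rank-one tensor `v^⊗p`, with entries `v_{i₁} ⋯ v_{i_p}`. -/
noncomputable def tpow {n : ℕ} (p : ℕ) (v : EuclideanSpace ℝ (Fin n)) : (Fin p → Fin n) → ℝ :=
  fun idx => ∏ k, v (idx k)

/-- `T x^⊗p = ∑_{i₁,…,i_p} T_{i₁,…,i_p} x_{i₁} ⋯ x_{i_p}`. -/
noncomputable def tapply {p n : ℕ} (T : (Fin p → Fin n) → ℝ) (x : EuclideanSpace ℝ (Fin n)) : ℝ :=
  ∑ idx : Fin p → Fin n, T idx * ∏ k, x (idx k)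

/-- A tensor is symmetric if its entries are invariant under all permutations of the indices. -/
def tsymm {p n : ℕ} (T : (Fin p → Fin n) → ℝ) : Prop :=
  ∀ (σ : Equiv.Perm (Fin p)) (idx : Fin p → Fin n), T (idx ∘ σ) = T idx

/-- Operator norm of a (symmetric) tensor: `sup_{‖x‖₂=1} |T x^⊗p|`. -/
noncomputable def tnorm {p n : ℕ} (T : (Fin p → Fin n) → ℝ) : ℝ :=
  sSup {r | ∃ x : EuclideanSpace ℝ (Fin n), ‖x‖ = 1 ∧ |tapply T x| = r}

/-- The extension of `tapply T` to complex vectors. -/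
noncomputable def ctapply {p n : ℕ} (T : (Fin p → Fin n) → ℝ) (z : Fin n → ℂ) : ℂ :=
  ∑ idx : Fin p → Fin n, (T idx : ℂ) * ∏ k, z (idx k)

theorem ctapply_ofReal {p n : ℕ} (T : (Fin p → Fin n) → ℝ) (x : EuclideanSpace ℝ (Fin n)) :
    ctapply T (fun i => (x i : ℂ)) = (tapply T x : ℂ) := by
  simp [ctapply, tapply]

theorem ctapply_mul {p n : ℕ} (T : (Fin p → Fin n) → ℝ) (c : ℂ) (z : Fin n → ℂ) :
    ctapply T (fun i => c * z i) = c ^ p * ctapply T z := by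
  simp only [ctapply, Finset.mul_sum, Finset.prod_mul_distrib, Finset.prod_const,
    Finset.card_univ, Fintype.card_fin]
  exact Finset.sum_congr rfl fun _ _ => by ring

theorem differentiable_ctapply_comp {p n : ℕ} (T : (Fin p → Fin n) → ℝ) {f : ℂ → Fin n → ℂ}
    (hf : ∀ i, Differentiable ℂ fun z => f z i) : Differentiable ℂ fun z => ctapply T (f z) := by
  unfold ctapply
  fun_prop

theorem abs_tapply_le_tnorm {p n : ℕ} (T : (Fin p → Fin n) → ℝ) {x : EuclideanSpace ℝ (Fin n)}
    (hx : ‖x‖ = 1) : |tapply T x| ≤ tnorm T := by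
  refine le_csSup ⟨∑ idx, |T idx|, ?_⟩ ⟨x, hx, rfl⟩
  rintro _ ⟨y, hy, rfl⟩
  refine (Finset.abs_sum_le_sum_abs _ _).trans (Finset.sum_le_sum fun idx _ => ?_)
  rw [abs_mul, Finset.abs_prod]
  refine mul_le_of_le_one_right (abs_nonneg _) (Finset.prod_le_one (fun _ _ => abs_nonneg _) ?_)
  exact fun k _ => hy ▸ PiLp.norm_apply_le y (idx k)

theorem tapply_tpow {n : ℕ} (p : ℕ) (v x : EuclideanSpace ℝ (Fin n)) :
    tapply (tpow p v) x = ⟪v, x⟫ ^ p := by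
  simp only [tapply, tpow, ← Finset.prod_mul_distrib, PiLp.inner_apply, Fintype.sum_pow]
  simp [mul_comm]

theorem tapply_sum_tpow_add {n p : ℕ} (lam : Fin n → ℝ) (v : Fin n → EuclideanSpace ℝ (Fin n))
    (E : (Fin p → Fin n) → ℝ) (x : EuclideanSpace ℝ (Fin n)) :
    tapply ((∑ i, lam i • tpow p (v i)) + E) x = ∑ i, lam i * ⟪v i, x⟫ ^ p + tapply E x := by
  simp only [← tapply_tpow, tapply, Pi.add_apply, Finset.sum_apply, Pi.smul_apply, smul_eq_mul,
    add_mul, Finset.sum_add_distrib, Finset.sum_mul, Finset.mul_sum]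
  rw [Finset.sum_comm]
  simp only [mul_assoc]

theorem norm_cos_smul_add_sin_smul {V : Type*} [NormedAddCommGroup V] [InnerProductSpace ℝ V]
    {x u : V} (hx : ‖x‖ = 1) (hu : ‖u‖ = 1) (hxu : ⟪x, u⟫ = 0) (θ : ℝ) :
    ‖Real.cos θ • x + Real.sin θ • u‖ = 1 := by
  have h := norm_add_sq_real (Real.cos θ • x) (Real.sin θ • u)
  simp only [real_inner_smul_left, real_inner_smul_right, hxu, norm_smul, hx, hu,
    Real.norm_eq_abs, mul_one, mul_zero, add_zero, sq_abs, Real.cos_sq_add_sin_sq] at h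
  nlinarith [norm_nonneg (Real.cos θ • x + Real.sin θ • u)]

theorem exp_I_mul_pow_mul_ctapply {p n : ℕ} (T : (Fin p → Fin n) → ℝ)
    (x u : EuclideanSpace ℝ (Fin n)) (z : ℂ) :
    Complex.exp (Complex.I * z) ^ p *
        ctapply T (fun i => Complex.cos z * x i + Complex.sin z * u i) =
      ctapply T (fun i => (Complex.exp (Complex.I * z) ^ 2 + 1) / 2 * x i
        - (Complex.exp (Complex.I * z) ^ 2 - 1) * Complex.I / 2 * u i) := by
  rw [← ctapply_mul]
  congr 1
  ext i
  have h : Complex.exp (Complex.I * z) * Complex.exp (-z * Complex.I) = 1 := by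
    rw [← Complex.exp_add]; simp [mul_comm]
  rw [Complex.cos, Complex.sin, mul_comm z Complex.I]
  linear_combination ((x i : ℂ) / 2 + Complex.I / 2 * u i) * h

/-- A homogeneous form of degree `p` restricted to a great circle extends to an entire function of
exponential type at most `p`. -/
theorem norm_ctapply_circle_le_of_im_nonneg {p n : ℕ} (T : (Fin p → Fin n) → ℝ)
    {x u : EuclideanSpace ℝ (Fin n)} (hx : ‖x‖ = 1) (hu : ‖u‖ = 1) (hxu : ⟪x, u⟫ = 0) {z : ℂ}
    (hz : 0 ≤ z.im) :
    ‖ctapply T (fun i => Complex.cos z * x i + Complex.sin z * u i)‖ ≤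
      tnorm T * Real.exp (p * z.im) := by
  set G : ℂ → ℂ := fun w => ctapply T (fun i => (w ^ 2 + 1) / 2 * x i
    - (w ^ 2 - 1) * Complex.I / 2 * u i) with hG
  have hGd : Differentiable ℂ G :=
    differentiable_ctapply_comp T fun i => by fun_prop
  have hcirc : ∀ w ∈ frontier (Metric.ball (0 : ℂ) 1), ‖G w‖ ≤ tnorm T := by
    intro w hw
    rw [frontier_ball _ one_ne_zero, mem_sphere_zero_iff_norm, Complex.norm_eq_one_iff] at hw
    obtain ⟨θ, rfl⟩ := hw
    rw [mul_comm (θ : ℂ), hG]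
    simp only [← exp_I_mul_pow_mul_ctapply, norm_mul, norm_pow, Complex.norm_exp_I_mul_ofReal,
      one_pow, one_mul]
    have h := ctapply_ofReal T (Real.cos θ • x + Real.sin θ • u)
    simp only [PiLp.add_apply, PiLp.smul_apply, smul_eq_mul, Complex.ofReal_add,
      Complex.ofReal_mul, Complex.ofReal_cos, Complex.ofReal_sin] at h
    rw [h, Complex.norm_real]
    exact abs_tapply_le_tnorm T (norm_cos_smul_add_sin_smul hx hu hxu θ)
  have hw : ‖Complex.exp (Complex.I * z)‖ = Real.exp (-z.im) := by
    simp [Complex.norm_exp]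
  have hmem : Complex.exp (Complex.I * z) ∈ closure (Metric.ball (0 : ℂ) 1) := by
    rw [closure_ball _ one_ne_zero, mem_closedBall_zero_iff, hw]
    simpa using hz
  have h := Complex.norm_le_of_forall_mem_frontier_norm_le Metric.isBounded_ball
    hGd.diffContOnCl hcirc hmem
  simp only [hG, ← exp_I_mul_pow_mul_ctapply, norm_mul, norm_pow, hw, ← Real.exp_nat_mul] at h
  rw [mul_neg, Real.exp_neg, inv_mul_eq_div, div_le_iff₀ (Real.exp_pos _)] at h
  exact h

theorem norm_ctapply_circle_le {p n : ℕ} (T : (Fin p → Fin n) → ℝ)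
    {x u : EuclideanSpace ℝ (Fin n)} (hx : ‖x‖ = 1) (hu : ‖u‖ = 1) (hxu : ⟪x, u⟫ = 0) (z : ℂ) :
    ‖ctapply T (fun i => Complex.cos z * x i + Complex.sin z * u i)‖ ≤
      tnorm T * Real.exp (p * |z.im|) := by
  rcases le_total 0 z.im with hz | hz
  · rw [abs_of_nonneg hz]
    exact norm_ctapply_circle_le_of_im_nonneg T hx hu hxu hz
  · have h := norm_ctapply_circle_le_of_im_nonneg T hx (u := -u) (by simpa using hu)
      (by simpa using hxu) (z := -z) (by simpa using hz)
    simpa [abs_of_nonpos hz] using h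

/-- A Bernstein-type inequality for homogeneous forms along great circles. -/
theorem exists_hasDerivAt_tapply_circle {p n : ℕ} (hp : 0 < p) (T : (Fin p → Fin n) → ℝ)
    {x u : EuclideanSpace ℝ (Fin n)} (hx : ‖x‖ = 1) (hu : ‖u‖ = 1) (hxu : ⟪x, u⟫ = 0) :
    ∃ D : ℝ, HasDerivAt (fun θ : ℝ => tapply T (Real.cos θ • x + Real.sin θ • u)) D 0 ∧
      |D| ≤ 3 * p * tnorm T := by
  set h : ℂ → ℂ := fun z => ctapply T (fun i => Complex.cos z * x i + Complex.sin z * u i) with hh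
  have hd : Differentiable ℂ h := differentiable_ctapply_comp T fun i => by fun_prop
  have hp' : (0 : ℝ) < p := Nat.cast_pos.2 hp
  have hT : 0 ≤ tnorm T := (abs_nonneg _).trans (abs_tapply_le_tnorm T hx)
  refine ⟨(deriv h 0).re, ?_, ?_⟩
  · convert (hd ((0 : ℝ) : ℂ)).hasDerivAt.real_of_complex using 1
    · ext θ
      have h := ctapply_ofReal T (Real.cos θ • x + Real.sin θ • u)
      simp only [PiLp.add_apply, PiLp.smul_apply, smul_eq_mul, Complex.ofReal_add,
        Complex.ofReal_mul, Complex.ofReal_cos, Complex.ofReal_sin] at h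
      simp only [hh, h, Complex.ofReal_re]
    · simp
  · have hb := Complex.norm_deriv_le_of_forall_mem_sphere_norm_le (c := 0) (R := 1 / p)
      (C := tnorm T * 3) (by positivity) hd.diffContOnCl fun z hz => by
        refine (norm_ctapply_circle_le T hx hu hxu z).trans
          (mul_le_mul_of_nonneg_left ?_ hT)
        refine le_trans (Real.exp_le_exp.2 ?_) Real.exp_one_lt_three.le
        rw [mem_sphere_zero_iff_norm] at hz
        have := hz ▸ Complex.abs_im_le_norm z
        rwa [le_div_iff₀ hp', mul_comm] at this
    refine (Complex.abs_re_le_norm _).trans (hb.trans (le_of_eq ?_))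
    field_simp

/-- First-order optimality of a maximizer over the unit sphere, with the perturbation term bounded
by the operator norm. -/
theorem abs_sum_mul_pow_mul_le_of_isMax {n p : ℕ} (hp : 0 < p) (lam : Fin n → ℝ)
    (v : Fin n → EuclideanSpace ℝ (Fin n)) (E : (Fin p → Fin n) → ℝ)
    {x u : EuclideanSpace ℝ (Fin n)} (hx : ‖x‖ = 1) (hu : ‖u‖ = 1) (hxu : ⟪x, u⟫ = 0)
    (hmax : ∀ y : EuclideanSpace ℝ (Fin n), ‖y‖ = 1 →
      tapply ((∑ i, lam i • tpow p (v i)) + E) y ≤ tapply ((∑ i, lam i • tpow p (v i)) + E) x) :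
    |∑ i, lam i * (⟪v i, x⟫ ^ (p - 1) * ⟪v i, u⟫)| ≤ 3 * tnorm E := by
  obtain ⟨D, hD, hDb⟩ := exists_hasDerivAt_tapply_circle hp E hx hu hxu
  have hp' : (0 : ℝ) < p := Nat.cast_pos.2 hp
  have hg : HasDerivAt
      (fun θ : ℝ => ∑ i, lam i * (Real.cos θ * ⟪v i, x⟫ + Real.sin θ * ⟪v i, u⟫) ^ p)
      (∑ i, lam i * (p * ⟪v i, x⟫ ^ (p - 1) * ⟪v i, u⟫)) 0 := by
    refine HasDerivAt.fun_sum fun i _ => HasDerivAt.const_mul _ ?_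
    have := (((Real.hasDerivAt_cos 0).mul_const ⟪v i, x⟫).add
      ((Real.hasDerivAt_sin 0).mul_const ⟪v i, u⟫)).pow p
    simp only [Real.cos_zero, Real.sin_zero, neg_zero, zero_mul, one_mul, zero_add, add_zero,
      Pi.add_apply] at this
    exact this
  have hf := hg.add hD
  have hloc : IsLocalMax ((fun θ : ℝ => ∑ i, lam i *
      (Real.cos θ * ⟪v i, x⟫ + Real.sin θ * ⟪v i, u⟫) ^ p) +
      fun θ : ℝ => tapply E (Real.cos θ • x + Real.sin θ • u)) 0 := by
    refine Filter.Eventually.of_forall fun θ => ?_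
    have := hmax _ (norm_cos_smul_add_sin_smul hx hu hxu θ)
    simpa [tapply_sum_tpow_add, inner_add_right, real_inner_smul_right] using this
  have h0 := hloc.hasDerivAt_eq_zero hf
  have hs : ∑ i, lam i * (p * ⟪v i, x⟫ ^ (p - 1) * ⟪v i, u⟫) =
      p * ∑ i, lam i * (⟪v i, x⟫ ^ (p - 1) * ⟪v i, u⟫) := by
    rw [Finset.mul_sum]
    exact Finset.sum_congr rfl fun _ _ => by ring
  rw [hs] at h0
  refine le_of_mul_le_mul_left ?_ hp'
  rw [← abs_of_pos hp', ← abs_mul, abs_of_pos hp', eq_neg_of_add_eq_zero_left h0, abs_neg]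
  linarith

theorem sum_inner_sq_of_orthonormal {n : ℕ} {v : Fin n → EuclideanSpace ℝ (Fin n)}
    (hv : Orthonormal ℝ v) (x : EuclideanSpace ℝ (Fin n)) : ∑ i, ⟪v i, x⟫ ^ 2 = ‖x‖ ^ 2 := by
  obtain ⟨b, hb⟩ := Orthonormal.exists_orthonormalBasis_extension_of_card_eq
    (𝕜 := ℝ) (E := EuclideanSpace ℝ (Fin n)) (by simp) (s := Set.univ)
    (hv.comp _ Subtype.val_injective)
  rw [← b.sum_sq_norm_inner_right x]
  simp [hb]

theorem norm_sub_sq_of_norm_eq_one {V : Type*} [NormedAddCommGroup V] [InnerProductSpace ℝ V]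
    {x w : V} (hx : ‖x‖ = 1) (hw : ‖w‖ = 1) : ‖x - w‖ ^ 2 = 2 * (1 - ⟪w, x⟫) := by
  rw [norm_sub_sq_real, hx, hw, real_inner_comm]
  ring

/-- Powers of the coordinates off `j` are controlled by the mass of the vector off `j`. -/
theorem abs_sum_erase_mul_pow_le {ι : Type*} [Fintype ι] [DecidableEq ι] {p : ℕ} (hp : 3 ≤ p)
    {lam c : ι → ℝ} (hlam : ∀ i, 0 ≤ lam i) {L s : ℝ} (hL : ∀ i, lam i ≤ L) (hs : 0 ≤ s)
    (hs1 : s ≤ 1) {j : ι} (hcs : ∑ i ∈ Finset.univ.erase j, c i ^ 2 = s ^ 2) :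
    |∑ i ∈ Finset.univ.erase j, lam i * c i ^ p| ≤ L * s ^ 3 := by
  have hc : ∀ i ∈ Finset.univ.erase j, |c i| ≤ s := fun i hi =>
    abs_le_of_sq_le_sq (hcs ▸ Finset.single_le_sum (fun k _ => sq_nonneg (c k)) hi) hs
  calc |∑ i ∈ Finset.univ.erase j, lam i * c i ^ p|
      ≤ ∑ i ∈ Finset.univ.erase j, L * s * c i ^ 2 := by
        refine (Finset.abs_sum_le_sum_abs _ _).trans (Finset.sum_le_sum fun i hi => ?_)
        have h1 : |c i| ^ p ≤ |c i| ^ 3 :=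
          pow_le_pow_of_le_one (abs_nonneg _) ((hc i hi).trans hs1) hp
        have h2 : |c i| ^ 3 ≤ s * c i ^ 2 := by
          rw [← sq_abs (c i), pow_succ']
          exact mul_le_mul_of_nonneg_right (hc i hi) (by positivity)
        rw [abs_mul, abs_pow, abs_of_nonneg (hlam i), mul_assoc]
        exact mul_le_mul (hL i) (h1.trans h2) (by positivity) ((hlam i).trans (hL i))
    _ = L * s ^ 3 := by rw [← Finset.mul_sum, hcs]; ring

theorem sum_mul_pow_le_of_isMax {ι : Type*} [Fintype ι] {p : ℕ} (hp : 2 ≤ p) {lam c : ι → ℝ}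
    (hc : ∑ i, c i ^ 2 = 1) {j : ι}
    (hj : ∀ i, lam i * c i ^ (p - 2) ≤ lam j * c j ^ (p - 2)) :
    ∑ i, lam i * c i ^ p ≤ lam j * c j ^ (p - 2) := by
  calc ∑ i, lam i * c i ^ p = ∑ i, lam i * c i ^ (p - 2) * c i ^ 2 :=
        Finset.sum_congr rfl fun i _ => by
          rw [mul_assoc, ← pow_add, Nat.sub_add_cancel hp]
    _ ≤ ∑ i, lam j * c j ^ (p - 2) * c i ^ 2 :=
        Finset.sum_le_sum fun i _ => mul_le_mul_of_nonneg_right (hj i) (sq_nonneg _)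
    _ = lam j * c j ^ (p - 2) := by rw [← Finset.mul_sum, hc, mul_one]

/-- The direction of steepest ascent of `⟪w, ·⟫` tangent to the unit sphere at `x`. -/
theorem exists_unit_tangent {V : Type*} [NormedAddCommGroup V] [InnerProductSpace ℝ V]
    {x w : V} (hx : ‖x‖ = 1) (hw : ‖w‖ = 1) {s : ℝ} (hs : 0 < s)
    (hsw : s ^ 2 = 1 - ⟪w, x⟫ ^ 2) :
    ‖s⁻¹ • (w - ⟪w, x⟫ • x)‖ = 1 ∧ ⟪x, s⁻¹ • (w - ⟪w, x⟫ • x)⟫ = 0 := by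
  have h : ‖w - ⟪w, x⟫ • x‖ ^ 2 = s ^ 2 := by
    rw [norm_sub_sq_real, norm_smul, real_inner_smul_right, hx, hw, Real.norm_eq_abs, mul_one,
      sq_abs, hsw]
    ring
  rw [norm_smul, norm_inv, Real.norm_of_nonneg hs.le, (sq_eq_sq₀ (norm_nonneg _) hs.le).1 h]
  refine ⟨inv_mul_cancel₀ hs.ne', ?_⟩
  simp [real_inner_smul_right, inner_sub_right, hx, real_inner_comm]

/-- Tangential mass of a near-maximizer is at most linear in the relative perturbation. -/
theorem mul_le_of_abs_sum_tangent_le {n p : ℕ} (hp : 3 ≤ p) {lam : Fin n → ℝ}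
    (hlam : ∀ i, 0 ≤ lam i) {v : Fin n → EuclideanSpace ℝ (Fin n)} (hv : Orthonormal ℝ v)
    {x : EuclideanSpace ℝ (Fin n)} (hx : ‖x‖ = 1) {j : Fin n} {s L C : ℝ} (hs : 0 < s)
    (hs1 : s ≤ 1) (hsw : s ^ 2 = 1 - ⟪v j, x⟫ ^ 2) (hL : ∀ i, lam i ≤ L) (hxj : 0 ≤ ⟪v j, x⟫)
    (h : |∑ i, lam i * (⟪v i, x⟫ ^ (p - 1) * ⟪v i, s⁻¹ • (v j - ⟪v j, x⟫ • x)⟫)| ≤ C) :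
    s * ⟪v j, x⟫ * (lam j * ⟪v j, x⟫ ^ (p - 2) - L * s) ≤ C := by
  set c : Fin n → ℝ := fun i => ⟪v i, x⟫ with hc
  have hsum : ∑ i ∈ Finset.univ.erase j, c i ^ 2 = s ^ 2 := by
    have := sum_inner_sq_of_orthonormal hv x
    rw [← Finset.add_sum_erase _ _ (Finset.mem_univ j), hx] at this
    rw [hsw]
    linarith
  have hoff := abs_le.1 (abs_sum_erase_mul_pow_le hp hlam hL hs.le hs1 hsum)
  have hterm : ∀ i ∈ Finset.univ.erase j,
      lam i * (c i ^ (p - 1) * ⟪v i, s⁻¹ • (v j - c j • x)⟫) =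
        -(s⁻¹ * c j) * (lam i * c i ^ p) := by
    intro i hi
    rw [real_inner_smul_right, inner_sub_right, real_inner_smul_right,
      hv.inner_eq_zero (Finset.ne_of_mem_erase hi), ← Nat.sub_add_cancel (show 1 ≤ p by lia),
      pow_succ]
    simp only [Nat.add_sub_cancel, hc]
    ring
  have hj : lam j * (c j ^ (p - 1) * ⟪v j, s⁻¹ • (v j - c j • x)⟫) =
      s * c j * (lam j * c j ^ (p - 2)) := by
    have : ⟪v j, s⁻¹ • (v j - c j • x)⟫ = s := by
      rw [real_inner_smul_right, inner_sub_right, real_inner_smul_right,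
        real_inner_self_eq_norm_sq, hv.norm_eq_one, inv_mul_eq_div, div_eq_iff hs.ne']
      linarith
    rw [this, show p - 1 = p - 2 + 1 by lia, pow_succ]
    ring
  have hsplit := (abs_le.1 h).2
  rw [← Finset.add_sum_erase _ _ (Finset.mem_univ j), hj, Finset.sum_congr rfl hterm,
    ← Finset.mul_sum] at hsplit
  have hb : s⁻¹ * c j * ∑ i ∈ Finset.univ.erase j, lam i * c i ^ p ≤ s * c j * (L * s) := by
    calc _ ≤ s⁻¹ * c j * (L * s ^ 3) :=
          mul_le_mul_of_nonneg_left hoff.2 (mul_nonneg (inv_nonneg.2 hs.le) hxj)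
      _ = _ := by field_simp
  linarith

/-- The distance between unit vectors with inner product `c` is linear in `r` for small `r` by
the tangential bound, and at most `2 * √r` or `2` otherwise. -/
theorem le_quadratic_of_sq_eq_of_tangent_bound {d c a r : ℝ} (hr : 0 ≤ r)
    (hdc : d ^ 2 = 2 * (1 - c)) (hc : -1 ≤ c) (ha : 1 - 2 * r ≤ a)
    (hac : r ≤ 1 / 2 → a ≤ c)
    (h : ∀ s : ℝ, 0 < s → s ≤ 1 → s ^ 2 = 1 - c ^ 2 → 0 ≤ c →
      s * c * (a - (a + 2 * r) * s) ≤ 3 * r) :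
    d ≤ 10 * (r + r ^ 2) := by
  rcases lt_or_ge (1 / 2) r with hr2 | hr2
  · refine le_trans (abs_le_of_sq_le_sq' (show d ^ 2 ≤ 2 ^ 2 by linarith) zero_le_two).2 ?_
    nlinarith
  have hca := hac hr2
  suffices hlin : d ≤ 10 * r by nlinarith [sq_nonneg r]
  refine (abs_le_of_sq_le_sq' ?_ (by positivity)).2
  rcases le_or_gt (1 / 25) r with hr3 | hr3
  · nlinarith
  have hc2 : 0 ≤ 1 - c ^ 2 := by nlinarith
  have hsq := Real.sq_sqrt hc2
  rcases (Real.sqrt_nonneg (1 - c ^ 2)).eq_or_lt with hs | hs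
  · rw [← hs] at hsq
    have : c = 1 := by nlinarith
    rw [hdc, this]
    nlinarith
  generalize √(1 - c ^ 2) = s at hsq hs
  have hs4 : s ≤ 2 / 5 := (abs_le_of_sq_le_sq' (by nlinarith) (by norm_num)).2
  have hs' := h s hs (by linarith) hsq (by linarith)
  have h1 : 13 / 25 ≤ a - (a + 2 * r) * s := by nlinarith
  have h2 : 23 / 25 * s ≤ s * c := by nlinarith
  have h3 : 23 / 25 * s * (13 / 25) ≤ s * c * (a - (a + 2 * r) * s) :=
    mul_le_mul h2 h1 (by norm_num) (h2.trans' (by positivity))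
  have h4 : s ≤ 7 * r := by linarith
  have h5 : s ^ 2 ≤ (7 * r) ^ 2 := pow_le_pow_left₀ hs.le h4 2
  nlinarith

/-- Theorem 2.1 of the paper. Let `p ≥ 3` be odd, `T̂ = ∑ λᵢ vᵢ^⊗p + E`
with `{vᵢ}` orthonormal, `λᵢ > 0`, `E` symmetric of operator norm `ε`. Let `x̂` maximize
`T̂ x^⊗p` over unit vectors and `λ̂ := T̂ x̂^⊗p`. Then there exists `j` with
`|λ̂ − λⱼ| ≤ ε` and `‖x̂ − vⱼ‖₂ ≤ 10 (ε/λⱼ + (ε/λⱼ)²)`. -/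
theorem sroa_single_rank_one_approximation
    {n : ℕ} (p : ℕ) (hodd : Odd p) (hp : 3 ≤ p)
    (lam : Fin n → ℝ) (hlam : ∀ i, 0 < lam i)
    (v : Fin n → EuclideanSpace ℝ (Fin n)) (hv : Orthonormal ℝ v)
    (E : (Fin p → Fin n) → ℝ) (hE : tsymm E)
    (ε : ℝ) (hε : ε = tnorm E)
    (Th : (Fin p → Fin n) → ℝ) (hTh : Th = (∑ i, lam i • tpow p (v i)) + E)
    (xh : EuclideanSpace ℝ (Fin n)) (hxh : ‖xh‖ = 1)
    (hmax : ∀ y : EuclideanSpace ℝ (Fin n), ‖y‖ = 1 → tapply Th y ≤ tapply Th xh) :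
    ∃ j : Fin n, |tapply Th xh - lam j| ≤ ε ∧
      ‖xh - v j‖ ≤ 10 * (ε / lam j + (ε / lam j)^2) := by
  subst hTh
  subst hε
  have : Nonempty (Fin n) := by
    by_contra h
    rw [not_nonempty_iff] at h
    simp [Subsingleton.elim xh 0] at hxh
  have hpodd : Odd (p - 2) := by
    obtain ⟨k, rfl⟩ := hodd
    exact ⟨k - 1, by lia⟩
  have hEx := abs_le.1 (abs_tapply_le_tnorm E hxh)
  have hc1 : ∑ i, ⟪v i, xh⟫ ^ 2 = 1 := by rw [sum_inner_sq_of_orthonormal hv, hxh, one_pow]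
  have hcle : ∀ i, |⟪v i, xh⟫| ≤ 1 := fun i => by
    simpa [hv.norm_eq_one, hxh] using abs_real_inner_le_norm (v i) xh
  have hlow : ∀ i, lam i - tnorm E ≤ tapply ((∑ i, lam i • tpow p (v i)) + E) xh := by
    intro i
    refine le_trans ?_ (hmax (v i) (hv.norm_eq_one i))
    have hi := (abs_le.1 (abs_tapply_le_tnorm E (hv.norm_eq_one i))).1
    have : ∑ k, lam k * ⟪v k, v i⟫ ^ p = lam i := by
      rw [Finset.sum_eq_single i]
      · simp [hv.norm_eq_one]
      · intro k _ hk
        simp [hv.inner_eq_zero hk, show p ≠ 0 by lia]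
      · simp
    rw [tapply_sum_tpow_add, this]
    linarith
  obtain ⟨j, -, hj⟩ := Finset.univ.exists_max_image (fun i => lam i * ⟪v i, xh⟫ ^ (p - 2))
    Finset.univ_nonempty
  have hupp := sum_mul_pow_le_of_isMax (show 2 ≤ p by lia) hc1 fun i => hj i (Finset.mem_univ i)
  have hval := tapply_sum_tpow_add lam v E xh
  have hpow1 : ⟪v j, xh⟫ ^ (p - 2) ≤ 1 := by
    refine (le_abs_self _).trans ?_
    rw [abs_pow]
    exact pow_le_one₀ (abs_nonneg _) (hcle j)
  have hA := mul_le_of_le_one_right (hlam j).le hpow1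
  refine ⟨j, abs_le.2 ⟨by linarith [hlow j], by linarith⟩, ?_⟩
  have hjpos := hlam j
  have hε0 : 0 ≤ tnorm E := (abs_nonneg _).trans (abs_tapply_le_tnorm E hxh)
  have hgap : ∀ i, lam i - 2 * tnorm E ≤ lam j * ⟪v j, xh⟫ ^ (p - 2) := fun i => by
    linarith [hlow i]
  have hsub := norm_sub_sq_of_norm_eq_one hxh (hv.norm_eq_one j)
  have hfo : ∀ s : ℝ, 0 < s → s ≤ 1 → s ^ 2 = 1 - ⟪v j, xh⟫ ^ 2 → 0 ≤ ⟪v j, xh⟫ →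
      s * ⟪v j, xh⟫ * (lam j * ⟪v j, xh⟫ ^ (p - 2) -
        (lam j * ⟪v j, xh⟫ ^ (p - 2) + 2 * tnorm E) * s) ≤ 3 * tnorm E := by
    intro s hs hs1 hsw hxj
    obtain ⟨hu, hxu⟩ := exists_unit_tangent hxh (hv.norm_eq_one j) hs hsw
    exact mul_le_of_abs_sum_tangent_le hp (fun i => (hlam i).le) hv hxh hs hs1 hsw
      (fun i => by linarith [hgap i]) hxj
      (abs_sum_mul_pow_mul_le_of_isMax (by lia) lam v E hxh hu hxu hmax)
  have hgapj := hgap j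
  have hcj := abs_le.1 (hcle j)
  obtain ⟨r, hr⟩ : ∃ r, r = tnorm E / lam j := ⟨_, rfl⟩
  have hEr : tnorm E = r * lam j := by rw [hr, div_mul_cancel₀ _ hjpos.ne']
  have hr0 : 0 ≤ r := hr ▸ div_nonneg hε0 hjpos.le
  rw [← hr]
  rw [hEr] at hfo hgapj
  have hxj_pow : 1 - 2 * r ≤ ⟪v j, xh⟫ ^ (p - 2) := by
    refine le_of_mul_le_mul_left ?_ hjpos
    linarith
  refine le_quadratic_of_sq_eq_of_tangent_bound hr0 hsub hcj.1 hxj_pow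
    (fun hr2 => ?_) fun s hs hs1 hsw hxj => ?_
  · have hxj : 0 ≤ ⟪v j, xh⟫ := hpodd.pow_nonneg_iff.1 (by linarith)
    exact pow_le_of_le_one hxj hcj.2 (by lia)
  · refine le_of_mul_le_mul_left ?_ hjpos
    linarith [hfo s hs hs1 hsw hxj]
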